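/- arXiv:physics/9906043 — 5 statements merged into one kernel-verified Lean document; each statement's English description precedes it below -/
import Mathlib

section
/- Let θ^{[N]}, θ ∈ 𝒫(M) with θ^{[N]} → θ weakly, let h : 𝒫(M) → ℝ be bounded and continuous, and for each N set V_N := −(1/N) log ∫_{M^N} exp(−N h(E_y)) (θ^{[N]})^{⊗N}(dy), where (θ^{[N]})^{⊗N} is the N-fold product measure on M^N. Then limsup_{N→∞} V_N ≤ inf_{φ∈𝒫(M)} [H(φ|θ) + h(φ)]. -/
open MeasureTheory Filter Topology ProbabilityTheory
open scoped ENNReal NNReal Classical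

noncomputable def empiricalMeasure {M : Type*} [MeasurableSpace M] [Nonempty M] (N : ℕ)
    (x : Fin N → M) : ProbabilityMeasure M :=
  if hN : N = 0 then ⟨Measure.dirac (Classical.arbitrary M), inferInstance⟩
  else ⟨(N : ℝ≥0∞)⁻¹ • ∑ i, Measure.dirac (x i), by
    constructor
    simp [Measure.smul_apply, Measure.finset_sum_apply]
    rw [ENNReal.inv_mul_cancel (by exact_mod_cast hN) (by simp)]⟩

/-- Relative entropy (Kullback-Leibler divergence) `H(φ|ψ)`:
`∫ log(dφ/dψ) dφ` if `φ ≪ ψ` (and the integral exists), `∞` otherwise. -/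
noncomputable def relEntropy {M : Type*} [MeasurableSpace M] (φ ψ : Measure M) : ℝ≥0∞ :=
  if φ ≪ ψ ∧ Integrable (llr φ ψ) φ then ENNReal.ofReal (∫ x, llr φ ψ x ∂φ) else ⊤

lemma aux_cont_integrable {X : Type*} [TopologicalSpace X] [CompactSpace X]
    [MeasurableSpace X] [OpensMeasurableSpace X] (μ : Measure X) [IsFiniteMeasure μ]
    {f : X → ℝ} (hf : Continuous f) : Integrable f μ :=
  BoundedContinuousFunction.integrable μ (BoundedContinuousFunction.mkOfCompact ⟨f, hf⟩)

lemma aux_pi_tilted {M : Type*} [MetricSpace M] [CompactSpace M]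
    [MeasurableSpace M] [BorelSpace M] (N : ℕ) (μ : Measure M) [IsProbabilityMeasure μ]
    (g : M → ℝ) (hg : Continuous g) :
    (Measure.pi fun _ : Fin N => μ).tilted (fun y => ∑ i, g (y i)) =
      Measure.pi fun _ : Fin N => μ.tilted g := by
  have hint : Integrable (fun x => Real.exp (g x)) μ :=
    aux_cont_integrable μ (Real.continuous_exp.comp hg)
  have := isProbabilityMeasure_tilted hint
  symm
  refine Measure.pi_eq fun s hs => ?_
  rw [tilted_apply_eq_ofReal_integral' _ (MeasurableSet.univ_pi hs), Measure.restrict_pi_pi]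
  have h1 : ∀ y : Fin N → M, Real.exp (∑ i, g (y i)) = ∏ i, Real.exp (g (y i)) :=
    fun y => Real.exp_sum _ _
  simp_rw [h1]
  rw [integral_div, integral_fintype_prod_eq_prod (fun _ x => Real.exp (g x)),
    integral_fintype_prod_eq_prod (fun _ x => Real.exp (g x)), ← Finset.prod_div_distrib,
    ENNReal.ofReal_prod_of_nonneg (fun i _ => by positivity)]
  refine Finset.prod_congr rfl fun i _ => ?_
  rw [tilted_apply_eq_ofReal_integral' _ (hs i), integral_div]

lemma aux_integral_empirical {M : Type*} [MetricSpace M] [Nonempty M]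
    [MeasurableSpace M] [BorelSpace M] (N : ℕ) (hN : N ≠ 0) (y : Fin N → M) (g : M → ℝ) :
    ∫ x, g x ∂(empiricalMeasure N y : Measure M) = (N : ℝ)⁻¹ * ∑ i, g (y i) := by
  have e : (empiricalMeasure N y : Measure M) = (N : ℝ≥0∞)⁻¹ • ∑ i, Measure.dirac (y i) := by
    exact congrArg Subtype.val (dif_neg hN)
  rw [e, integral_smul_measure, integral_finsetSum_measure]
  · simp
  · intro i _
    exact integrable_dirac (by simp)

lemma aux_cont_empirical {M : Type*} [MetricSpace M] [Nonempty M]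
    [MeasurableSpace M] [BorelSpace M] (N : ℕ) (hN : N ≠ 0) :
    Continuous (fun y : Fin N → M => empiricalMeasure N y) := by
  rw [continuous_iff_continuousAt]
  intro y
  refine ProbabilityMeasure.tendsto_iff_forall_integral_tendsto.2 fun f => ?_
  simp_rw [aux_integral_empirical N hN]
  have : Continuous fun y : Fin N → M => (N : ℝ)⁻¹ * ∑ i, f (y i) := by fun_prop
  exact this.tendsto y

/-- Gibbs / Donsker--Varadhan bound. -/
lemma aux_jensen {M : Type*} [MetricSpace M] [CompactSpace M] [Nonempty M]
    [MeasurableSpace M] [BorelSpace M] (N : ℕ) (hN : N ≠ 0) (μ : Measure M)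
    [IsProbabilityMeasure μ] (g : M → ℝ) (hg : Continuous g)
    (h : ProbabilityMeasure M → ℝ) (hcont : Continuous h) :
    -((N : ℝ)⁻¹ * Real.log (∫ y : Fin N → M,
      Real.exp (-(N : ℝ) * h (empiricalMeasure N y)) ∂ (Measure.pi fun _ : Fin N => μ))) ≤
    ∫ x, g x ∂(μ.tilted g) - Real.log (∫ x, Real.exp (g x) ∂μ)
      + ∫ y : Fin N → M, h (empiricalMeasure N y) ∂(Measure.pi fun _ : Fin N => μ.tilted g) := by
  have hint : Integrable (fun x => Real.exp (g x)) μ :=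
    aux_cont_integrable μ (Real.continuous_exp.comp hg)
  have := isProbabilityMeasure_tilted hint
  have hcE : Continuous fun y : Fin N → M => h (empiricalMeasure N y) :=
    hcont.comp (aux_cont_empirical N hN)
  set u : (Fin N → M) → ℝ := fun y => -(N : ℝ) * h (empiricalMeasure N y) with hu
  have hcu : Continuous u := continuous_const.mul hcE
  set G : (Fin N → M) → ℝ := fun y => ∑ i, g (y i) with hG
  have hcG : Continuous G := by fun_prop
  have key := integral_exp_tilted (μ := Measure.pi fun _ : Fin N => μ) G (fun y => u y - G y)
  have e1 : ∀ y, (G + fun y => u y - G y) y = u y := fun y => by simp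
  simp_rw [e1] at key
  rw [hG, aux_pi_tilted N μ g hg] at key
  have hZ : ∫ y : Fin N → M, Real.exp (∑ i, g (y i)) ∂(Measure.pi fun _ : Fin N => μ)
      = (∫ x, Real.exp (g x) ∂μ) ^ N := by
    simp_rw [Real.exp_sum]
    rw [integral_fintype_prod_eq_prod (fun _ x => Real.exp (g x))]
    simp
  rw [hZ] at key
  have hzpos : 0 < ∫ x, Real.exp (g x) ∂μ := integral_exp_pos hint
  set Φ := Measure.pi fun _ : Fin N => μ.tilted g with hΦ
  have hJ : Real.exp (∫ y, (u y - G y) ∂Φ) ≤ ∫ y, Real.exp (u y - G y) ∂Φ := by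
    refine convexOn_exp.map_integral_le Real.continuous_exp.continuousOn isClosed_univ
      (Eventually.of_forall fun _ => Set.mem_univ _) ?_ ?_
    · exact aux_cont_integrable Φ (hcu.sub hcG)
    · exact aux_cont_integrable Φ (Real.continuous_exp.comp (hcu.sub hcG))
  have hI : 0 < ∫ y, Real.exp (u y) ∂(Measure.pi fun _ : Fin N => μ) :=
    integral_exp_pos (aux_cont_integrable _ (Real.continuous_exp.comp hcu))
  have hlog : ∫ y, (u y - G y) ∂Φ ≤
      Real.log (∫ y, Real.exp (u y) ∂(Measure.pi fun _ : Fin N => μ))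
       - N * Real.log (∫ x, Real.exp (g x) ∂μ) := by
    rw [← Real.log_pow, ← Real.log_div hI.ne' (pow_pos hzpos N).ne', ← key]
    exact (Real.le_log_iff_exp_le (lt_of_lt_of_le (Real.exp_pos _) hJ)).2 hJ
  have hsplit : ∫ y, (u y - G y) ∂Φ =
      -(N : ℝ) * ∫ y, h (empiricalMeasure N y) ∂Φ - N * ∫ x, g x ∂(μ.tilted g) := by
    rw [integral_sub (aux_cont_integrable Φ hcu) (aux_cont_integrable Φ hcG), hu,
      integral_const_mul, hG, integral_finsetSum]
    · congr 1
      rw [Finset.sum_congr rfl (fun i _ => integral_comp_eval (μ := fun _ : Fin N => μ.tilted g)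
        (i := i) hg.aestronglyMeasurable)]
      simp
    · intro i _
      exact aux_cont_integrable Φ (by fun_prop)
  rw [hsplit] at hlog
  have hNpos : (0 : ℝ) < N := by exact_mod_cast Nat.pos_of_ne_zero hN
  change -((N : ℝ)⁻¹ * Real.log (∫ y, Real.exp (u y) ∂(Measure.pi fun _ : Fin N => μ))) ≤ _
  rw [← sub_nonneg]
  have : 0 ≤ (N : ℝ)⁻¹ * ((Real.log (∫ y, Real.exp (u y) ∂(Measure.pi fun _ : Fin N => μ))
       - N * Real.log (∫ x, Real.exp (g x) ∂μ)) - (-(N : ℝ) * ∫ y, h (empiricalMeasure N y) ∂Φ - N * ∫ x, g x ∂(μ.tilted g))) :=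
    mul_nonneg (by positivity) (sub_nonneg.2 hlog)
  refine this.trans_eq ?_
  generalize ∫ y, Real.exp (u y) ∂(Measure.pi fun _ : Fin N => μ) = I0
  field_simp
  ring

/-- Filter of sets that have asymptotically full probability for the empirical measure. -/
def auxFilter {M : Type*} [MetricSpace M] [Nonempty M] [MeasurableSpace M]
    (φs : ℕ → ProbabilityMeasure M) : Filter (ProbabilityMeasure M) where
  sets := {S | Tendsto (fun N => (Measure.pi fun _ : Fin N => (φs N : Measure M))
    {y | empiricalMeasure N y ∉ S}) atTop (𝓝 0)}
  univ_sets := by simp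
  sets_of_superset := by
    intro S T hS hST
    refine tendsto_of_tendsto_of_tendsto_of_le_of_le tendsto_const_nhds hS
      (fun _ => zero_le) fun N => measure_mono fun y hy => ?_
    exact fun h => hy (hST h)
  inter_sets := by
    intro S T hS hT
    have h0 := Tendsto.add hS hT
    rw [add_zero] at h0
    refine tendsto_of_tendsto_of_tendsto_of_le_of_le tendsto_const_nhds h0
      (fun _ => zero_le) fun N => (measure_mono fun y hy => ?_).trans (measure_union_le _ _)
    by_contra hc
    simp only [Set.mem_union, Set.mem_ofPred_eq, not_or, not_not] at hc
    exact hy hc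

lemma aux_mem_filter {M : Type*} [MetricSpace M] [Nonempty M] [MeasurableSpace M]
    (φs : ℕ → ProbabilityMeasure M) (S : Set (ProbabilityMeasure M)) :
    S ∈ auxFilter φs ↔ Tendsto (fun N => (Measure.pi fun _ : Fin N => (φs N : Measure M))
    {y | empiricalMeasure N y ∉ S}) atTop (𝓝 0) := Iff.rfl

lemma aux_cheb {M : Type*} [MetricSpace M] [CompactSpace M] [Nonempty M]
    [MeasurableSpace M] [BorelSpace M] (N : ℕ) (hN : N ≠ 0) (μ : Measure M)
    [IsProbabilityMeasure μ] (f : BoundedContinuousFunction M ℝ) (c : ℝ) (hc : 0 < c) :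
    (Measure.pi fun _ : Fin N => μ)
      {y | c ≤ |∫ x, f x ∂(empiricalMeasure N y : Measure M) - ∫ x, f x ∂μ|} ≤
      ENNReal.ofReal ((N : ℝ)⁻¹ * (‖f‖ ^ 2 / c ^ 2)) := by
  have hNpos : (0 : ℝ) < N := by exact_mod_cast Nat.pos_of_ne_zero hN
  have hmem : MemLp (fun x => f x) 2 μ :=
    MemLp.of_bound f.continuous.aestronglyMeasurable ‖f‖ (Eventually.of_forall f.norm_coe_le_norm)
  set X : (Fin N → M) → ℝ := fun y => (N : ℝ)⁻¹ * ∑ i, f (y i) with hX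
  have hXc : Continuous X := by fun_prop
  have hXm : MemLp X 2 (Measure.pi fun _ : Fin N => μ) := by
    refine MemLp.of_bound hXc.aestronglyMeasurable ‖f‖ (Eventually.of_forall fun y => ?_)
    rw [hX, norm_mul, norm_inv, Real.norm_natCast, inv_mul_le_iff₀ hNpos]
    refine (norm_sum_le _ _).trans ((Finset.sum_le_sum fun i _ => f.norm_coe_le_norm _).trans ?_)
    simp
  have hmean : ∫ y, X y ∂(Measure.pi fun _ : Fin N => μ) = ∫ x, f x ∂μ := by
    rw [hX, integral_const_mul, integral_finsetSum]
    · rw [Finset.sum_congr rfl (fun i _ => integral_comp_eval (μ := fun _ : Fin N => μ)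
        (i := i) f.continuous.aestronglyMeasurable)]
      simp
      field_simp
    · intro i _
      exact aux_cont_integrable _ (by fun_prop)
  have hvar : variance X (Measure.pi fun _ : Fin N => μ) ≤ (N : ℝ)⁻¹ * ‖f‖ ^ 2 := by
    have e : X = fun y => (N : ℝ)⁻¹ * (∑ i : Fin N, fun y : Fin N → M => f (y i)) y := by
      funext y
      simp [hX]
    rw [e, variance_const_mul, variance_sum_pi (fun _ => hmem)]
    have hv : variance (fun x => f x) μ ≤ ‖f‖ ^ 2 := by
      refine (variance_le_sq_of_bounded (a := -‖f‖) (b := ‖f‖) (Eventually.of_forall fun x => ?_)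
        f.continuous.measurable.aemeasurable).trans_eq (by ring)
      exact abs_le.1 (f.norm_coe_le_norm x)
    simp only [Finset.sum_const, Finset.card_univ, Fintype.card_fin, nsmul_eq_mul]
    calc ((N : ℝ)⁻¹) ^ 2 * (N * variance (fun x => f x) μ)
        = (N : ℝ)⁻¹ * variance (fun x => f x) μ := by field_simp
      _ ≤ _ := by gcongr
  have := meas_ge_le_variance_div_sq hXm hc
  rw [hmean] at this
  simp_rw [aux_integral_empirical N hN]
  refine this.trans (ENNReal.ofReal_le_ofReal ?_)
  rw [← mul_div_assoc]
  gcongr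

lemma aux_filter_le {M : Type*} [MetricSpace M] [CompactSpace M] [Nonempty M]
    [MeasurableSpace M] [BorelSpace M] (φs : ℕ → ProbabilityMeasure M) (φ : ProbabilityMeasure M)
    (hφ : Tendsto φs atTop (𝓝 φ)) : auxFilter φs ≤ 𝓝 φ := by
  change Tendsto id (auxFilter φs) (𝓝 φ)
  refine ProbabilityMeasure.tendsto_iff_forall_integral_tendsto.2 fun f => ?_
  rw [Metric.tendsto_nhds]
  intro ε hε
  rw [Filter.Eventually, aux_mem_filter]
  have h1 := ProbabilityMeasure.tendsto_iff_forall_integral_tendsto.1 hφ f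
  have h2 := (Metric.tendsto_nhds.1 h1) (ε / 2) (half_pos hε)
  have h3 : Tendsto (fun N : ℕ => ENNReal.ofReal ((N : ℝ)⁻¹ * (‖f‖ ^ 2 / (ε / 2) ^ 2))) atTop
      (𝓝 0) := by
    have : Tendsto (fun N : ℕ => (N : ℝ)⁻¹ * (‖f‖ ^ 2 / (ε / 2) ^ 2)) atTop (𝓝 0) := by
      simpa using (tendsto_inv_atTop_nhds_zero_nat (𝕜 := ℝ)).mul_const (‖f‖ ^ 2 / (ε / 2) ^ 2)
    simpa using ENNReal.tendsto_ofReal this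
  refine tendsto_of_tendsto_of_tendsto_of_le_of_le' tendsto_const_nhds h3
    (Eventually.of_forall fun _ => zero_le) ?_
  filter_upwards [h2, eventually_ne_atTop 0] with N hN hN0
  refine (measure_mono fun y hy => ?_).trans (aux_cheb N hN0 (φs N) f (ε / 2) (half_pos hε))
  simp only [Set.mem_ofPred_eq, id, not_lt] at hy ⊢
  rw [Real.dist_eq] at hy hN
  have := abs_sub_le (∫ x, f x ∂(empiricalMeasure N y : Measure M)) (∫ x, f x ∂(φs N : Measure M))
    (∫ x, f x ∂(φ : Measure M))
  linarith

lemma aux_lln {M : Type*} [MetricSpace M] [CompactSpace M] [Nonempty M]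
    [MeasurableSpace M] [BorelSpace M] (φs : ℕ → ProbabilityMeasure M) (φ : ProbabilityMeasure M)
    (hφ : Tendsto φs atTop (𝓝 φ))
    (h : ProbabilityMeasure M → ℝ) (hcont : Continuous h) (hbdd : ∃ C, ∀ φ, |h φ| ≤ C) :
    Tendsto (fun N => ∫ y : Fin N → M, h (empiricalMeasure N y)
      ∂(Measure.pi fun _ : Fin N => (φs N : Measure M))) atTop (𝓝 (h φ)) := by
  obtain ⟨C, hC⟩ := hbdd
  have hC0 : 0 ≤ C := (abs_nonneg _).trans (hC φ)
  rw [Metric.tendsto_nhds]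
  intro ε hε
  have h1 : {ψ | |h ψ - h φ| < ε / 2} ∈ auxFilter φs :=
    aux_filter_le φs φ hφ ((Metric.tendsto_nhds.1 (hcont.tendsto φ)) (ε / 2) (half_pos hε))
  rw [aux_mem_filter] at h1
  have h2 := (ENNReal.tendsto_toReal (ENNReal.zero_ne_top)).comp h1
  have h3 := h2.const_mul (2 * C)
  simp only [ENNReal.toReal_zero, mul_zero] at h3
  filter_upwards [(h3.eventually_lt_const (half_pos hε)), eventually_ne_atTop 0] with N hN hN0
  set P := Measure.pi fun _ : Fin N => (φs N : Measure M) with hP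
  have hcE : Continuous fun y : Fin N → M => h (empiricalMeasure N y) :=
    hcont.comp (aux_cont_empirical N hN0)
  set B : Set (Fin N → M) := {y | empiricalMeasure N y ∉ {ψ | |h ψ - h φ| < ε / 2}} with hB
  have hBm : MeasurableSet B := by
    have : B = (fun y : Fin N → M => |h (empiricalMeasure N y) - h φ|) ⁻¹' Set.Ici (ε / 2) := by
      ext y
      simp [hB]
    rw [this]
    exact (hcE.sub continuous_const).abs.measurable measurableSet_Ici
  have e1 : ∫ y, h (empiricalMeasure N y) ∂P - h φ = ∫ y, (h (empiricalMeasure N y) - h φ) ∂P := by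
    rw [integral_sub (aux_cont_integrable P hcE) (integrable_const _)]
    simp
  rw [Real.dist_eq, e1]
  have hle : ∀ y, |h (empiricalMeasure N y) - h φ| ≤ ε / 2 + B.indicator (fun _ => 2 * C) y := by
    intro y
    by_cases hy : y ∈ B
    · rw [Set.indicator_of_mem hy]
      have := abs_sub (h (empiricalMeasure N y)) (h φ)
      have := hC φ
      have := hC (empiricalMeasure N y)
      linarith
    · rw [Set.indicator_of_notMem hy]
      simp only [hB, Set.mem_ofPred_eq, not_not] at hy
      linarith
  have hind : Integrable (B.indicator (fun _ => 2 * C)) P :=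
    (integrable_const _).indicator hBm
  calc |∫ y, (h (empiricalMeasure N y) - h φ) ∂P|
      ≤ ∫ y, |h (empiricalMeasure N y) - h φ| ∂P := abs_integral_le_integral_abs
    _ ≤ ∫ y, (ε / 2 + B.indicator (fun _ => 2 * C) y) ∂P :=
        integral_mono (aux_cont_integrable P (hcE.sub continuous_const).abs)
          ((integrable_const _).add hind) hle
    _ = ε / 2 + 2 * C * P.real B := by
        rw [integral_add (integrable_const _) hind, integral_indicator_const _ hBm]
        simp [mul_comm]
    _ < ε := by
        have : 2 * C * P.real B < ε / 2 := hN
        linarith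

/-- the bound for a continuous strictly positive (unnormalised) density `exp g`. -/
lemma aux_continuous_bound {M : Type*} [MetricSpace M] [CompactSpace M] [Nonempty M]
    [MeasurableSpace M] [BorelSpace M]
    (θseq : ℕ → ProbabilityMeasure M) (θ : ProbabilityMeasure M)
    (hθ : Tendsto θseq atTop (𝓝 θ))
    (h : ProbabilityMeasure M → ℝ) (hcont : Continuous h) (hbdd : ∃ C, ∀ φ, |h φ| ≤ C)
    (V : ℕ → ℝ)
    (hV : ∀ N, V N = -((N : ℝ)⁻¹ * Real.log (∫ y : Fin N → M,
      Real.exp (-(N : ℝ) * h (empiricalMeasure N y))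
        ∂ (Measure.pi fun _ : Fin N => (θseq N : Measure M)))))
    (g : M → ℝ) (hg : Continuous g) (φ : ProbabilityMeasure M)
    (hφ : ∀ k : BoundedContinuousFunction M ℝ, ∫ x, k x ∂(φ : Measure M) =
      (∫ x, Real.exp (g x) * k x ∂(θ : Measure M)) / ∫ x, Real.exp (g x) ∂(θ : Measure M)) :
    limsup (fun N => ((V N : ℝ) : EReal)) atTop ≤
      (((∫ x, Real.exp (g x) * g x ∂(θ : Measure M)) / (∫ x, Real.exp (g x) ∂(θ : Measure M))
        - Real.log (∫ x, Real.exp (g x) ∂(θ : Measure M)) + h φ : ℝ) : EReal) := by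
  have hint : ∀ μ : ProbabilityMeasure M, Integrable (fun x => Real.exp (g x)) (μ : Measure M) :=
    fun μ => aux_cont_integrable _ (Real.continuous_exp.comp hg)
  have hpos : ∀ μ : ProbabilityMeasure M, 0 < ∫ x, Real.exp (g x) ∂(μ : Measure M) :=
    fun μ => integral_exp_pos (hint μ)
  have hlim : ∀ k : M → ℝ, Continuous k → Tendsto (fun N => ∫ x, k x ∂(θseq N : Measure M)) atTop
      (𝓝 (∫ x, k x ∂(θ : Measure M))) := fun k hk =>
    ProbabilityMeasure.tendsto_iff_forall_integral_tendsto.1 hθ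
      (BoundedContinuousFunction.mkOfCompact ⟨k, hk⟩)
  have hZ := hlim (fun x => Real.exp (g x)) (by fun_prop)
  set φs : ℕ → ProbabilityMeasure M := fun N => ⟨(θseq N : Measure M).tilted g,
    isProbabilityMeasure_tilted (hint (θseq N))⟩ with hφs
  have htil : ∀ N (k : M → ℝ), ∫ x, k x ∂((θseq N : Measure M).tilted g) =
      (∫ x, Real.exp (g x) * k x ∂(θseq N : Measure M)) /
        ∫ x, Real.exp (g x) ∂(θseq N : Measure M) := by
    intro N k
    rw [integral_tilted, ← integral_div]
    congr 1
    funext x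
    simp only [smul_eq_mul]
    ring
  have hconv : Tendsto φs atTop (𝓝 φ) := by
    refine ProbabilityMeasure.tendsto_iff_forall_integral_tendsto.2 fun k => ?_
    rw [hφ k]
    simp only [hφs, ProbabilityMeasure.coe_mk, htil]
    exact (hlim _ (by fun_prop)).div hZ (hpos θ).ne'
  have hT : Tendsto (fun N => ∫ x, g x ∂((θseq N : Measure M).tilted g)
      - Real.log (∫ x, Real.exp (g x) ∂(θseq N : Measure M))
      + ∫ y : Fin N → M, h (empiricalMeasure N y)
        ∂(Measure.pi fun _ : Fin N => (φs N : Measure M))) atTop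
      (𝓝 ((∫ x, Real.exp (g x) * g x ∂(θ : Measure M)) / (∫ x, Real.exp (g x) ∂(θ : Measure M))
        - Real.log (∫ x, Real.exp (g x) ∂(θ : Measure M)) + h φ)) := by
    simp only [htil]
    exact (((hlim _ (by fun_prop)).div hZ (hpos θ).ne').sub (hZ.log (hpos θ).ne')).add
      (aux_lln φs φ hconv h hcont hbdd)
  rw [← ((continuous_coe_real_ereal.tendsto _).comp hT).limsup_eq]
  refine limsup_le_limsup ?_
  filter_upwards [eventually_ne_atTop 0] with N hN
  rw [hV N]
  exact EReal.coe_le_coe_iff.2 (aux_jensen N hN (θseq N : Measure M) g hg h hcont)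

/-- the bound attached to the unnormalised density `f`. -/
def AuxGood {M : Type*} [MetricSpace M] [MeasurableSpace M] [BorelSpace M]
    (L : EReal) (θ : ProbabilityMeasure M) (h : ProbabilityMeasure M → ℝ) (f : M → ℝ) : Prop :=
  ∀ φ : ProbabilityMeasure M, (∀ k : BoundedContinuousFunction M ℝ, ∫ x, k x ∂(φ : Measure M) =
      (∫ x, f x * k x ∂(θ : Measure M)) / ∫ x, f x ∂(θ : Measure M)) →
    L ≤ (((∫ x, f x * Real.log (f x) ∂(θ : Measure M)) / (∫ x, f x ∂(θ : Measure M))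
        - Real.log (∫ x, f x ∂(θ : Measure M)) + h φ : ℝ) : EReal)

lemma aux_exists_density {M : Type*} [MetricSpace M] [MeasurableSpace M] [BorelSpace M]
    (θ : ProbabilityMeasure M) (f : M → ℝ) (hf : Measurable f) (h0 : ∀ x, 0 ≤ f x)
    (hint : Integrable f (θ : Measure M)) (hZ : 0 < ∫ x, f x ∂(θ : Measure M)) :
    ∃ φ : ProbabilityMeasure M, ∀ k : BoundedContinuousFunction M ℝ, ∫ x, k x ∂(φ : Measure M) =
      (∫ x, f x * k x ∂(θ : Measure M)) / ∫ x, f x ∂(θ : Measure M) := by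
  set Z := ∫ x, f x ∂(θ : Measure M) with hZd
  have hm : Measurable fun x => ENNReal.ofReal (f x / Z) := (hf.div_const Z).ennreal_ofReal
  have hP : IsProbabilityMeasure ((θ : Measure M).withDensity fun x => ENNReal.ofReal (f x / Z)) := by
    constructor
    rw [withDensity_apply _ MeasurableSet.univ, setLIntegral_univ,
      ← ofReal_integral_eq_lintegral_ofReal (hint.div_const Z)
        (Eventually.of_forall fun x => div_nonneg (h0 x) hZ.le), integral_div, ← hZd,
      div_self hZ.ne', ENNReal.ofReal_one]
  refine ⟨⟨_, hP⟩, fun k => ?_⟩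
  simp only [ProbabilityMeasure.coe_mk]
  rw [integral_withDensity_eq_integral_toReal_smul hm (Eventually.of_forall fun x => by simp),
    ← integral_div]
  congr 1
  funext x
  rw [ENNReal.toReal_ofReal (div_nonneg (h0 x) hZ.le), smul_eq_mul]
  ring

lemma aux_closure {M : Type*} [MetricSpace M] [MeasurableSpace M] [BorelSpace M]
    (L : EReal) (θ : ProbabilityMeasure M) (h : ProbabilityMeasure M → ℝ) (hcont : Continuous h)
    (fs : ℕ → M → ℝ) (f : M → ℝ) (G G' : M → ℝ) (hG : Integrable G (θ : Measure M))
    (hG' : Integrable G' (θ : Measure M)) (hfs : ∀ n, Measurable (fs n))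
    (h0 : ∀ n x, 0 ≤ fs n x) (hle : ∀ n x, fs n x ≤ G x)
    (hle' : ∀ n x, |fs n x * Real.log (fs n x)| ≤ G' x)
    (hlim : ∀ᵐ x ∂(θ : Measure M), Tendsto (fun n => fs n x) atTop (𝓝 (f x)))
    (hZ : 0 < ∫ x, f x ∂(θ : Measure M)) (hgood : ∀ n, AuxGood L θ h (fs n)) :
    AuxGood L θ h f := by
  intro φ hφ
  have hint : ∀ n, Integrable (fs n) (θ : Measure M) := fun n =>
    hG.mono' (hfs n).aestronglyMeasurable (Eventually.of_forall fun x => by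
      rw [Real.norm_of_nonneg (h0 n x)]; exact hle n x)
  have t1 : Tendsto (fun n => ∫ x, fs n x ∂(θ : Measure M)) atTop (𝓝 (∫ x, f x ∂(θ : Measure M))) :=
    tendsto_integral_of_dominated_convergence G (fun n => (hfs n).aestronglyMeasurable) hG
      (fun n => Eventually.of_forall fun x => by
        rw [Real.norm_of_nonneg (h0 n x)]; exact hle n x) hlim
  have t2 : Tendsto (fun n => ∫ x, fs n x * Real.log (fs n x) ∂(θ : Measure M)) atTop
      (𝓝 (∫ x, f x * Real.log (f x) ∂(θ : Measure M))) := by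
    refine tendsto_integral_of_dominated_convergence G'
      (fun n => (Real.continuous_mul_log.measurable.comp (hfs n)).aestronglyMeasurable) hG'
      (fun n => Eventually.of_forall fun x => hle' n x) ?_
    filter_upwards [hlim] with x hx
    exact (Real.continuous_mul_log.tendsto _).comp hx
  have t3 : ∀ k : BoundedContinuousFunction M ℝ,
      Tendsto (fun n => ∫ x, fs n x * k x ∂(θ : Measure M)) atTop
      (𝓝 (∫ x, f x * k x ∂(θ : Measure M))) := by
    intro k
    refine tendsto_integral_of_dominated_convergence (fun x => G x * ‖k‖)
      (fun n => ((hfs n).mul k.continuous.measurable).aestronglyMeasurable) (hG.mul_const _)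
      (fun n => Eventually.of_forall fun x => ?_) ?_
    · rw [norm_mul, Real.norm_of_nonneg (h0 n x)]
      exact mul_le_mul (hle n x) (k.norm_coe_le_norm x) (norm_nonneg _) ((h0 n x).trans (hle n x))
    · filter_upwards [hlim] with x hx
      exact hx.mul_const _
  obtain ⟨n0, hn0⟩ := eventually_atTop.1 (t1.eventually_const_lt hZ)
  have hex : ∀ n, ∃ φn : ProbabilityMeasure M, ∀ k : BoundedContinuousFunction M ℝ,
      ∫ x, k x ∂(φn : Measure M) =
      (∫ x, fs (n + n0) x * k x ∂(θ : Measure M)) / ∫ x, fs (n + n0) x ∂(θ : Measure M) :=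
    fun n => aux_exists_density θ _ (hfs _) (h0 _) (hint _) (hn0 _ (by omega))
  choose φs hφs using hex
  have t1' := (tendsto_add_atTop_iff_nat n0).2 t1
  have t2' := (tendsto_add_atTop_iff_nat n0).2 t2
  have hconv : Tendsto φs atTop (𝓝 φ) := by
    refine ProbabilityMeasure.tendsto_iff_forall_integral_tendsto.2 fun k => ?_
    rw [hφ k]
    simp only [hφs]
    exact ((tendsto_add_atTop_iff_nat n0).2 (t3 k)).div t1' hZ.ne'
  have hT := ((t2'.div t1' hZ.ne').sub (t1'.log hZ.ne')).add ((hcont.tendsto φ).comp hconv)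
  exact ge_of_tendsto' ((continuous_coe_real_ereal.tendsto _).comp hT)
    fun n => hgood (n + n0) (φs n) (hφs n)

/-- from continuous densities to bounded measurable ones. -/
lemma aux_bounded {M : Type*} [MetricSpace M] [CompactSpace M] [MeasurableSpace M] [BorelSpace M]
    (L : EReal) (θ : ProbabilityMeasure M) (h : ProbabilityMeasure M → ℝ) (hcont : Continuous h)
    (hgood : ∀ f : M → ℝ, Continuous f → (∀ x, 0 < f x) → AuxGood L θ h f)
    (f : M → ℝ) (hf : Measurable f) (a b : ℝ) (ha : 0 < a) (hab : a ≤ b)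
    (hfa : ∀ x, a ≤ f x) (hfb : ∀ x, f x ≤ b) :
    AuxGood L θ h f := by
  have hfn : ∀ x, ‖f x‖ ≤ b := fun x => by
    rw [Real.norm_of_nonneg (ha.le.trans (hfa x))]; exact hfb x
  have hmem : MemLp f 1 (θ : Measure M) :=
    MemLp.of_bound hf.aestronglyMeasurable b (Eventually.of_forall hfn)
  have hex : ∀ n : ℕ, ∃ g : BoundedContinuousFunction M ℝ,
      eLpNorm (f - (g : M → ℝ)) 1 (θ : Measure M) ≤ ENNReal.ofReal (1 / ((n : ℝ) + 1)) := by
    intro n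
    obtain ⟨g, hg, _⟩ := hmem.exists_boundedContinuous_eLpNorm_sub_le ENNReal.one_ne_top
      (ε := ENNReal.ofReal (1 / ((n : ℝ) + 1))) (by
        rw [ne_eq, ENNReal.ofReal_eq_zero, not_le]; positivity)
    exact ⟨g, hg⟩
  choose gs hgs using hex
  have htm : TendstoInMeasure (θ : Measure M) (fun n => (gs n : M → ℝ)) atTop f := by
    refine tendstoInMeasure_of_tendsto_eLpNorm one_ne_zero
      (fun n => (gs n).continuous.aestronglyMeasurable) hf.aestronglyMeasurable ?_
    have h3 : Tendsto (fun n : ℕ => ENNReal.ofReal (1 / ((n : ℝ) + 1))) atTop (𝓝 0) := by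
      simpa using ENNReal.tendsto_ofReal (tendsto_one_div_add_atTop_nhds_zero_nat (𝕜 := ℝ))
    refine tendsto_of_tendsto_of_tendsto_of_le_of_le tendsto_const_nhds h3
      (fun _ => zero_le) fun n => ?_
    rw [eLpNorm_sub_comm]
    exact hgs n
  obtain ⟨ns, _, hns⟩ := htm.exists_seq_tendsto_ae
  obtain ⟨K, hK⟩ := (isCompact_Icc (a := a) (b := b)).exists_bound_of_continuousOn
    Real.continuous_mul_log.continuousOn
  have hmemI : ∀ t : ℝ, min (max t a) b ∈ Set.Icc a b := fun t =>
    ⟨le_min (le_max_right _ _) hab, min_le_right _ _⟩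
  refine aux_closure L θ h hcont (fun n x => min (max (gs (ns n) x) a) b) f (fun _ => b)
    (fun _ => K) (integrable_const _) (integrable_const _) (fun n => ?_) (fun n x => ?_)
    (fun n x => (hmemI _).2) (fun n x => hK _ (hmemI _)) ?_ ?_ (fun n => ?_)
  · exact Continuous.measurable (by fun_prop)
  · exact ha.le.trans (hmemI _).1
  · filter_upwards [hns] with x hx
    have : Tendsto (fun n => min (max (gs (ns n) x) a) b) atTop (𝓝 (min (max (f x) a) b)) :=
      (hx.max tendsto_const_nhds).min tendsto_const_nhds
    rwa [max_eq_left (hfa x), min_eq_left (hfb x)] at this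
  · have : ∫ _, a ∂(θ : Measure M) ≤ ∫ x, f x ∂(θ : Measure M) :=
      integral_mono (integrable_const _) (memLp_one_iff_integrable.1 hmem) hfa
    simp at this
    exact ha.trans_le this
  · exact hgood _ (by fun_prop) fun x => ha.trans_le (hmemI _).1

lemma aux_mul_log_bound (t c : ℝ) (ht : 0 ≤ t) (hc : 1 ≤ c) :
    |min (max t c⁻¹) c * Real.log (min (max t c⁻¹) c)| ≤ |t * Real.log t| + 1 := by
  have hc0 : 0 < c := by linarith
  have hci : c⁻¹ ≤ 1 := inv_le_one_of_one_le₀ hc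
  have habs := abs_nonneg (t * Real.log t)
  rcases le_total t c⁻¹ with h1 | h1
  · rw [max_eq_right h1, min_eq_left (hci.trans hc), mul_comm]
    have := Real.abs_log_mul_self_lt c⁻¹ (by positivity) hci
    linarith
  · rw [max_eq_left h1]
    rcases le_total t c with h2 | h2
    · rw [min_eq_left h2]
      linarith
    · rw [min_eq_right h2]
      have hl : 0 ≤ Real.log c := Real.log_nonneg hc
      have hl' : Real.log c ≤ Real.log t := Real.log_le_log hc0 h2
      rw [abs_of_nonneg (mul_nonneg hc0.le hl), abs_of_nonneg (mul_nonneg ht (hl.trans hl'))]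
      have := mul_le_mul h2 hl' hl ht
      linarith

/-- Upper Laplace bound: limsup V_N ≤ inf [H(φ|θ) + h(φ)]. -/
theorem stmt2 {M : Type*} [MetricSpace M] [CompactSpace M] [Nonempty M]
    [MeasurableSpace M] [BorelSpace M]
    (θseq : ℕ → ProbabilityMeasure M) (θ : ProbabilityMeasure M)
    (hθ : Tendsto θseq atTop (𝓝 θ))
    (h : ProbabilityMeasure M → ℝ) (hcont : Continuous h) (hbdd : ∃ C, ∀ φ, |h φ| ≤ C)
    (V : ℕ → ℝ)
    (hV : ∀ N, V N = -((N : ℝ)⁻¹ * Real.log (∫ y : Fin N → M,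
      Real.exp (-(N : ℝ) * h (empiricalMeasure N y))
        ∂ (Measure.pi fun _ : Fin N => (θseq N : Measure M))))) :
    limsup (fun N => ((V N : ℝ) : EReal)) atTop ≤
      ⨅ φ : ProbabilityMeasure M,
        ((relEntropy (φ : Measure M) (θ : Measure M) : ℝ≥0∞) : EReal) + ((h φ : ℝ) : EReal) := by
  refine le_iInf fun φ => ?_
  unfold relEntropy
  split_ifs with hφ
  swap
  · simp
  obtain ⟨hac, hllr⟩ := hφ
  set f : M → ℝ := fun x => ((φ : Measure M).rnDeriv (θ : Measure M) x).toReal with hf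
  have hfm : Measurable f := (Measure.measurable_rnDeriv _ _).ennreal_toReal
  have hf0 : ∀ x, 0 ≤ f x := fun x => ENNReal.toReal_nonneg
  have hfi : Integrable f (θ : Measure M) := Measure.integrable_toReal_rnDeriv
  have hfli : Integrable (fun x => f x * Real.log (f x)) (θ : Measure M) :=
    (integrable_rnDeriv_mul_log_iff hac).2 hllr
  have hZ : ∫ x, f x ∂(θ : Measure M) = 1 := by
    have := integral_rnDeriv_smul (f := fun _ : M => (1 : ℝ)) hac
    simpa using this
  set L := limsup (fun N => ((V N : ℝ) : EReal)) atTop with hL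
  have hg1 : ∀ f : M → ℝ, Continuous f → (∀ x, 0 < f x) → AuxGood L θ h f := by
    intro f hf hpos φ hφ
    have e : ∀ x, Real.exp (Real.log (f x)) = f x := fun x => Real.exp_log (hpos x)
    have := aux_continuous_bound θseq θ hθ h hcont hbdd V hV (fun x => Real.log (f x))
      (hf.log fun x => (hpos x).ne') φ (by simpa only [e] using hφ)
    simpa only [e] using this
  have hgood : AuxGood L θ h f := by
    have hcn : ∀ n : ℕ, (1 : ℝ) ≤ (n : ℝ) + 1 := fun n => by
      have : (0 : ℝ) ≤ n := n.cast_nonneg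
      linarith
    have hci : ∀ n : ℕ, ((n : ℝ) + 1)⁻¹ ≤ 1 := fun n => inv_le_one_of_one_le₀ (hcn n)
    refine aux_closure L θ h hcont (fun (n : ℕ) x => min (max (f x) ((n : ℝ) + 1)⁻¹) ((n : ℝ) + 1)) f
      (fun x => f x + 1) (fun x => |f x * Real.log (f x)| + 1) (hfi.add (integrable_const _))
      (hfli.abs.add (integrable_const _)) (fun n => by fun_prop) (fun n x => ?_) (fun n x => ?_)
      (fun n x => aux_mul_log_bound _ _ (hf0 x) (hcn n)) ?_ (by rw [hZ]; exact one_pos) fun n => ?_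
    · positivity
    · refine (min_le_left _ _).trans (max_le ?_ ?_)
      · linarith
      · linarith [hci n, hf0 x]
    · refine Eventually.of_forall fun x => ?_
      have ht : Tendsto (fun n : ℕ => max (f x) ((n : ℝ) + 1)⁻¹) atTop (𝓝 (f x)) := by
        have := (tendsto_const_nhds (x := f x)).max
          (tendsto_one_div_add_atTop_nhds_zero_nat (𝕜 := ℝ))
        simpa [max_eq_left (hf0 x)] using this
      refine ht.congr' ?_
      filter_upwards [eventually_ge_atTop ⌈f x⌉₊] with n hn
      have h1 : f x ≤ n := (Nat.le_ceil _).trans (by exact_mod_cast hn)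
      rw [min_eq_left (max_le (by linarith) ((hci n).trans (hcn n)))]
    · refine aux_bounded L θ h hcont hg1 _ (by fun_prop) ((n : ℝ) + 1)⁻¹ ((n : ℝ) + 1)
        (by positivity) ((hci n).trans (hcn n)) (fun x => ?_) (fun x => min_le_right _ _)
      exact le_min (le_max_right _ _) ((hci n).trans (hcn n))
  have hfin := hgood φ (fun k => by
    rw [hZ, div_one]
    exact (integral_rnDeriv_smul (f := fun x => k x) hac).symm)
  rw [hZ, integral_rnDeriv_mul_log hac, div_one, Real.log_one, sub_zero, EReal.coe_add] at hfin
  refine hfin.trans (add_le_add ?_ le_rfl)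
  rw [EReal.coe_ennreal_ofReal]
  exact EReal.coe_le_coe_iff.2 (le_max_left _ _)
end

section
/- Let θ^{[N]}, θ ∈ 𝒫(M) with θ^{[N]} → θ weakly, let h : 𝒫(M) → ℝ be bounded and continuous, and for each N set V_N := −(1/N) log ∫_{M^N} exp(−N h(E_y)) (θ^{[N]})^{⊗N}(dy), where (θ^{[N]})^{⊗N} is the N-fold product measure on M^N. Then liminf_{N→∞} V_N ≥ inf_{φ∈𝒫(M)} [H(φ|θ) + h(φ)]. -/
open MeasureTheory Filter Topology ProbabilityTheory
open scoped ENNReal NNReal Classical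

lemma aux_clip_nonneg (r : ℝ) (n : ℕ) :
    0 ≤ r * Real.log (max (Real.exp (-(n:ℝ))) (min r (Real.exp n)))
      - max (Real.exp (-(n:ℝ))) (min r (Real.exp n)) + 1 := by
  set c := max (Real.exp (-(n:ℝ))) (min r (Real.exp n)) with hc
  have hc0 : 0 < c := lt_of_lt_of_le (Real.exp_pos _) (le_max_left _ _)
  have h1 := InformationTheory.klFun_nonneg hc0.le
  rw [InformationTheory.klFun_apply] at h1
  have hn : (0:ℝ) ≤ n := Nat.cast_nonneg n
  have hle : Real.exp (-(n:ℝ)) ≤ Real.exp n := Real.exp_le_exp.2 (by linarith)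
  have h2 : 0 ≤ (r - c) * Real.log c := by
    rcases le_total r (Real.exp (-(n:ℝ))) with h | h
    · have : c = Real.exp (-(n:ℝ)) := by
        rw [hc, min_eq_left (h.trans hle), max_eq_left h]
      rw [this, Real.log_exp]; nlinarith
    · rcases le_total r (Real.exp n) with h' | h'
      · have : c = r := by rw [hc, min_eq_left h', max_eq_right h]
        rw [this]; simp
      · have : c = Real.exp n := by rw [hc, min_eq_right h', max_eq_right hle]
        rw [this, Real.log_exp]; nlinarith
  nlinarith

lemma aux_clip_tendsto {r : ℝ} (hr : 0 ≤ r) :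
    Tendsto (fun n : ℕ => r * Real.log (max (Real.exp (-(n:ℝ))) (min r (Real.exp n)))
      - max (Real.exp (-(n:ℝ))) (min r (Real.exp n)) + 1) atTop
      (𝓝 (InformationTheory.klFun r)) := by
  have hc : Tendsto (fun n : ℕ => max (Real.exp (-(n:ℝ))) (min r (Real.exp n))) atTop (𝓝 r) := by
    have h1 : Tendsto (fun n : ℕ => Real.exp (-(n:ℝ))) atTop (𝓝 0) :=
      Real.tendsto_exp_neg_atTop_nhds_zero.comp tendsto_natCast_atTop_atTop
    have h2 : Tendsto (fun n : ℕ => min r (Real.exp n)) atTop (𝓝 r) := by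
      apply tendsto_const_nhds.congr'
      have := (Real.tendsto_exp_atTop.comp tendsto_natCast_atTop_atTop).eventually_ge_atTop r
        (α := ℕ)
      filter_upwards [this] with n hn
      exact (min_eq_left hn).symm
    have := h1.max h2
    rwa [max_eq_right hr] at this
  have h3 : Tendsto (fun n : ℕ => r * Real.log (max (Real.exp (-(n:ℝ))) (min r (Real.exp n))))
      atTop (𝓝 (r * Real.log r)) := by
    rcases hr.eq_or_lt with h | h
    · simp [← h]
    · exact (hc.log h.ne').const_mul r
  have := (h3.sub hc).add_const 1
  convert this using 2
  rw [InformationTheory.klFun_apply]; ring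

lemma aux_bddmeas {M : Type*} [MeasurableSpace M] (φ θ : Measure M) [IsProbabilityMeasure φ]
    [IsProbabilityMeasure θ] (c : ℝ) (hc : ((c : ℝ) : EReal) < ((relEntropy φ θ : ℝ≥0∞) : EReal)) :
    ∃ f : M → ℝ, ∃ B : ℝ, Measurable f ∧ (∀ x, |f x| ≤ B) ∧
      c < ∫ x, f x ∂φ - (∫ x, Real.exp (f x) ∂θ - 1) := by
  rcases lt_or_ge c 0 with hc0 | hc0
  · exact ⟨fun _ => 0, 0, measurable_const, by simp, by simpa using hc0⟩
  have hkl : relEntropy φ θ = InformationTheory.klDiv φ θ := by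
    rw [InformationTheory.klDiv_def, relEntropy]
    simp
  by_cases hac : φ ≪ θ
  swap
  · have : ∃ A, MeasurableSet A ∧ θ A = 0 ∧ φ A ≠ 0 := by
      by_contra hcon
      push Not at hcon
      exact hac (Measure.AbsolutelyContinuous.mk hcon)
    obtain ⟨A, hA, h0, h1⟩ := this
    have hpos : 0 < φ.real A := by
      rw [measureReal_def]; exact ENNReal.toReal_pos h1 (measure_ne_top _ _)
    set t := (c + 1) / φ.real A with ht
    refine ⟨A.indicator (fun _ => t), |t|, measurable_const.indicator hA, ?_, ?_⟩
    · intro x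
      by_cases hx : x ∈ A <;> simp [hx]
    · rw [integral_indicator_const _ hA]
      have : ∫ x, Real.exp (A.indicator (fun _ => t) x) ∂θ = 1 := by
        have h2 : (fun x => Real.exp (A.indicator (fun _ => t) x)) =ᵐ[θ] fun _ => (1:ℝ) := by
          have : ∀ᵐ x ∂θ, x ∉ A := measure_eq_zero_iff_ae_notMem.1 h0
          filter_upwards [this] with x hx
          simp [hx]
        rw [integral_congr_ae h2]; simp
      rw [this, ht, smul_eq_mul, mul_div_cancel₀ _ hpos.ne']
      linarith
  rw [hkl, InformationTheory.klDiv_eq_lintegral_klFun_of_ac hac] at hc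
  set r : M → ℝ := fun x => (φ.rnDeriv θ x).toReal with hr
  have hrm : Measurable r := (Measure.measurable_rnDeriv _ _).ennreal_toReal
  have hr0 : ∀ x, 0 ≤ r x := fun x => ENNReal.toReal_nonneg
  let k : ℕ → M → ℝ := fun n x => max (Real.exp (-(n:ℝ))) (min (r x) (Real.exp n))
  have hkm : ∀ n, Measurable (k n) := fun n =>
    measurable_const.max (hrm.min measurable_const)
  have hk0 : ∀ n x, 0 < k n x := fun n x =>
    lt_of_lt_of_le (Real.exp_pos _) (le_max_left _ _)
  have hkub : ∀ n x, k n x ≤ Real.exp n := fun n x =>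
    max_le (Real.exp_le_exp.2 (by have : (0:ℝ) ≤ n := Nat.cast_nonneg n
                                  linarith)) (min_le_right _ _)
  have hkb : ∀ n x, |Real.log (k n x)| ≤ n := by
    intro n x
    rw [abs_le]
    constructor
    · rw [Real.le_log_iff_exp_le (hk0 n x)]; exact le_max_left _ _
    · rw [Real.log_le_iff_le_exp (hk0 n x)]; exact hkub n x
  let g : ℕ → M → ℝ := fun n x => r x * Real.log (k n x) - k n x + 1
  have hgm : ∀ n, Measurable (g n) := fun n =>
    ((hrm.mul (hkm n).log).sub (hkm n)).add measurable_const
  have hfatou : ∫⁻ x, ENNReal.ofReal (InformationTheory.klFun (r x)) ∂θ ≤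
      liminf (fun n => ∫⁻ x, ENNReal.ofReal (g n x) ∂θ) atTop := by
    refine le_trans (le_of_eq ?_) (lintegral_liminf_le fun n => (hgm n).ennreal_ofReal)
    congr 1
    ext x
    exact (ENNReal.tendsto_ofReal (aux_clip_tendsto (hr0 x))).liminf_eq.symm
  have hc' : ENNReal.ofReal c < ∫⁻ x, ENNReal.ofReal (InformationTheory.klFun (r x)) ∂θ := by
    rw [← EReal.coe_ennreal_lt_coe_ennreal_iff]
    rwa [EReal.coe_ennreal_ofReal, max_eq_left hc0]
  obtain ⟨n, hn⟩ := (eventually_lt_of_lt_liminf (hc'.trans_le hfatou)).exists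
  have hrint : Integrable r θ := Measure.integrable_toReal_rnDeriv
  have hi2 : Integrable (k n) θ := by
    refine Integrable.of_bound (hkm n).aestronglyMeasurable (Real.exp n) (ae_of_all _ fun x => ?_)
    rw [Real.norm_of_nonneg (hk0 n x).le]; exact hkub n x
  have hi1 : Integrable (fun x => r x * Real.log (k n x)) θ := by
    refine hrint.mul_bdd (c := n) (hkm n).log.aestronglyMeasurable (ae_of_all _ fun x => ?_)
    exact hkb n x
  have hgi : Integrable (g n) θ := (hi1.sub hi2).add (integrable_const _)
  rw [← ofReal_integral_eq_lintegral_ofReal hgi (ae_of_all _ fun x => aux_clip_nonneg (r x) n)] at hn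
  have hn' := (ENNReal.ofReal_lt_ofReal_iff_of_nonneg hc0).1 hn
  refine ⟨fun x => Real.log (k n x), n, (hkm n).log, hkb n, ?_⟩
  have e1 : ∫ x, Real.log (k n x) ∂φ = ∫ x, r x * Real.log (k n x) ∂θ :=
    (integral_rnDeriv_smul hac).symm
  have e2 : ∫ x, Real.exp (Real.log (k n x)) ∂θ = ∫ x, k n x ∂θ := by
    congr 1; ext x; exact Real.exp_log (hk0 n x)
  have e3 : ∫ x, g n x ∂θ = ∫ x, r x * Real.log (k n x) ∂θ - ∫ x, k n x ∂θ + 1 := by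
    have : ∫ x, g n x ∂θ = ∫ x, (r x * Real.log (k n x) - k n x) ∂θ + ∫ x, (1:ℝ) ∂θ :=
      integral_add (hi1.sub hi2) (integrable_const _)
    rw [this, integral_sub hi1 hi2]; simp
  rw [e1, e2]; linarith

lemma aux_exp_lip {B a b : ℝ} (ha : a ≤ B) (hb : b ≤ B) :
    Real.exp a - Real.exp b ≤ Real.exp B * |a - b| := by
  rcases le_total a b with h | h
  · have := Real.exp_le_exp.2 h
    have : 0 ≤ Real.exp B * |a - b| := by positivity
    linarith
  · rw [abs_of_nonneg (by linarith)]
    have h1 : Real.exp a * (1 + (b - a)) ≤ Real.exp b := by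
      have : Real.exp b = Real.exp a * Real.exp (b - a) := by rw [← Real.exp_add]; ring_nf
      rw [this]
      have := Real.add_one_le_exp (b - a)
      exact mul_le_mul_of_nonneg_left (by linarith) (Real.exp_pos a).le
    have h2 : Real.exp a * (a - b) ≤ Real.exp B * (a - b) :=
      mul_le_mul_of_nonneg_right (Real.exp_le_exp.2 ha) (by linarith)
    linarith

lemma aux_cont {M : Type*} [MetricSpace M] [CompactSpace M]
    [MeasurableSpace M] [BorelSpace M] (φ θ : Measure M) [IsProbabilityMeasure φ]
    [IsProbabilityMeasure θ] (c : ℝ) (hc : ((c : ℝ) : EReal) < ((relEntropy φ θ : ℝ≥0∞) : EReal)) :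
    ∃ f : C(M, ℝ), c < ∫ x, f x ∂φ - (∫ x, Real.exp (f x) ∂θ - 1) := by
  obtain ⟨f, B, hfm, hfB, hf⟩ := aux_bddmeas φ θ c hc
  set d := ∫ x, f x ∂φ - (∫ x, Real.exp (f x) ∂θ - 1) - c with hd
  have hdpos : 0 < d := by linarith
  have hfi : Integrable f (φ + θ) :=
    Integrable.of_bound hfm.aestronglyMeasurable B (ae_of_all _ hfB)
  set ε := d / (2 * (1 + Real.exp B)) with hε
  have hBp := Real.exp_pos B
  have hεpos : 0 < ε := by positivity
  obtain ⟨g, hg, hgi⟩ := hfi.exists_boundedContinuous_integral_sub_le hεpos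
  let k : C(M, ℝ) := ⟨fun x => max (-B) (min (g x) B), by fun_prop⟩
  have hkx : ∀ x, k x = max (-B) (min (g x) B) := fun x => rfl
  have hB0 : ∀ _ : M, 0 ≤ B := fun x => (abs_nonneg _).trans (hfB x)
  have hkB : ∀ x, k x ≤ B := fun x => by
    rw [hkx]; exact max_le (by have := hB0 x; linarith) (min_le_right _ _)
  have hkfg : ∀ x, |f x - k x| ≤ |f x - g x| := by
    intro x
    have h1 := abs_le.1 (hfB x)
    have : f x = max (-B) (min (f x) B) := by rw [min_eq_left h1.2, max_eq_right h1.1]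
    rw [hkx]
    conv_lhs => rw [this]
    refine (abs_max_sub_max_le_max _ _ _ _).trans ?_
    rw [sub_self, abs_zero, max_eq_right (abs_nonneg _)]
    refine (abs_min_sub_min_le_max _ _ _ _).trans ?_
    rw [sub_self, abs_zero, max_eq_left (abs_nonneg _)]
  have hki : ∀ (μ : Measure M) [IsFiniteMeasure μ], Integrable k μ := fun μ _ =>
    k.continuous.integrable_of_hasCompactSupport (HasCompactSupport.of_compactSpace _)
  have hkei : ∀ (μ : Measure M) [IsFiniteMeasure μ], Integrable (fun x => Real.exp (k x)) μ :=
    fun μ _ => (Real.continuous_exp.comp k.continuous).integrable_of_hasCompactSupport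
      (HasCompactSupport.of_compactSpace _)
  have hfe : Integrable (fun x => Real.exp (f x)) θ := by
    refine Integrable.of_bound hfm.exp.aestronglyMeasurable (Real.exp B) (ae_of_all _ fun x => ?_)
    rw [Real.norm_of_nonneg (Real.exp_pos _).le]
    exact Real.exp_le_exp.2 (abs_le.1 (hfB x)).2
  have hfφ : Integrable f φ := hfi.left_of_add_measure
  have hfθ : Integrable f θ := hfi.right_of_add_measure
  have hsum : ∫ x, |f x - k x| ∂φ + ∫ x, |f x - k x| ∂θ ≤ ε := by
    have hgi' : Integrable (fun x => |f x - g x|) (φ + θ) := (hfi.sub hgi).abs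
    have hki' : Integrable (fun x => |f x - k x|) (φ + θ) := (hfi.sub (hki _)).abs
    rw [← integral_add_measure hki'.left_of_add_measure hki'.right_of_add_measure]
    exact (integral_mono hki' hgi' hkfg).trans hg
  have hp1 : 0 ≤ ∫ x, |f x - k x| ∂φ := integral_nonneg fun x => abs_nonneg _
  have hp2 : 0 ≤ ∫ x, |f x - k x| ∂θ := integral_nonneg fun x => abs_nonneg _
  have b1 : ∫ x, f x ∂φ - ∫ x, k x ∂φ ≤ ∫ x, |f x - k x| ∂φ := by
    rw [← integral_sub hfφ (hki _)]
    exact integral_mono (hfφ.sub (hki _)) (hfφ.sub (hki _)).abs fun x => le_abs_self _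
  have b2 : ∫ x, Real.exp (k x) ∂θ - ∫ x, Real.exp (f x) ∂θ ≤
      Real.exp B * ∫ x, |f x - k x| ∂θ := by
    rw [← integral_sub (hkei _) hfe, ← integral_const_mul]
    refine integral_mono ((hkei _).sub hfe) ((hfθ.sub (hki _)).abs.const_mul _) fun x => ?_
    have := aux_exp_lip (hkB x) (abs_le.1 (hfB x)).2
    rwa [abs_sub_comm] at this
  refine ⟨k, ?_⟩
  have e1 : ε * (1 + Real.exp B) = d / 2 := by rw [hε]; field_simp
  have b3 : Real.exp B * ∫ x, |f x - k x| ∂θ ≤ Real.exp B * ε :=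
    mul_le_mul_of_nonneg_left (by linarith) hBp.le
  nlinarith

lemma aux_emp_integral {M : Type*} [MeasurableSpace M] [Nonempty M]
    [TopologicalSpace M] [OpensMeasurableSpace M] {N : ℕ} (hN : N ≠ 0) (y : Fin N → M)
    {f : M → ℝ} (hf : Continuous f) :
    ∫ x, f x ∂(empiricalMeasure N y : Measure M) = (N : ℝ)⁻¹ * ∑ i, f (y i) := by
  have hs : ∀ i, ∫ x, f x ∂(Measure.dirac (y i)) = f (y i) := fun i =>
    integral_dirac' f (y i) hf.measurable.stronglyMeasurable
  have hi : ∀ i ∈ (Finset.univ : Finset (Fin N)), Integrable f (Measure.dirac (y i)) := fun i _ =>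
    integrable_dirac' hf.measurable.stronglyMeasurable (by simp)
  have : (empiricalMeasure N y : Measure M) = (N : ℝ≥0∞)⁻¹ • ∑ i, Measure.dirac (y i) := by
    simp [empiricalMeasure, hN]
  rw [this, integral_smul_measure, integral_finset_sum_measure hi]
  simp [hs]

lemma aux_emp_cont {M : Type*} [MetricSpace M] [Nonempty M]
    [MeasurableSpace M] [BorelSpace M] (N : ℕ) :
    Continuous (empiricalMeasure N : (Fin N → M) → ProbabilityMeasure M) := by
  by_cases hN : N = 0
  · subst hN
    exact continuous_of_const fun x y => by rw [Subsingleton.elim x y]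
  rw [continuous_iff_continuousAt]
  intro y
  rw [ContinuousAt, ProbabilityMeasure.tendsto_iff_forall_integral_tendsto]
  intro f
  simp_rw [aux_emp_integral hN _ f.continuous]
  have : Continuous fun y : Fin N → M => (N : ℝ)⁻¹ * ∑ i, f (y i) := by fun_prop
  exact this.tendsto y

lemma aux_main {M : Type*} [MetricSpace M] [CompactSpace M] [Nonempty M]
    [MeasurableSpace M] [BorelSpace M]
    (θseq : ℕ → ProbabilityMeasure M) (θ : ProbabilityMeasure M)
    (hθ : Tendsto θseq atTop (𝓝 θ))
    (h : ProbabilityMeasure M → ℝ) (hcont : Continuous h) (a : ℝ)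
    (ha : ∀ φ : ProbabilityMeasure M, ((a - h φ : ℝ) : EReal) <
      ((relEntropy (φ : Measure M) (θ : Measure M) : ℝ≥0∞) : EReal)) (δ : ℝ) (hδ : 0 < δ) :
    ∀ᶠ N : ℕ in atTop, a - δ ≤ -((N : ℝ)⁻¹ * Real.log (∫ y : Fin N → M,
      Real.exp (-(N : ℝ) * h (empiricalMeasure N y))
        ∂ (Measure.pi fun _ : Fin N => (θseq N : Measure M)))) := by
  choose F hF using fun φ : ProbabilityMeasure M => aux_cont (φ : Measure M) (θ : Measure M) _ (ha φ)
  let I : C(M, ℝ) → ProbabilityMeasure M → ℝ := fun f μ => ∫ x, f x ∂(μ : Measure M)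
  have hI : ∀ f, Continuous (I f) := by
    intro f
    rw [continuous_iff_continuousAt]
    intro μ
    have := (ProbabilityMeasure.tendsto_iff_forall_integral_tendsto (μs := id) (F := 𝓝 μ)
      (μ := μ)).1 tendsto_id (BoundedContinuousFunction.mkOfCompact f)
    exact this
  let E : C(M, ℝ) → C(M, ℝ) := fun f => ⟨fun x => Real.exp (f x), by fun_prop⟩
  let U : ProbabilityMeasure M → Set (ProbabilityMeasure M) := fun φ =>
    {ψ | a - h ψ < I (F φ) ψ - (I (E (F φ)) θ - 1)}
  have hU : ∀ φ, IsOpen (U φ) := fun φ =>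
    isOpen_lt (continuous_const.sub hcont) ((hI _).sub continuous_const)
  obtain ⟨t, ht⟩ := isCompact_univ.elim_finite_subcover U hU
    (fun φ _ => Set.mem_iUnion.2 ⟨φ, hF φ⟩)
  have hev : ∀ᶠ N : ℕ in atTop, ∀ φ ∈ t, I (E (F φ)) (θseq N) < I (E (F φ)) θ + δ / 2 := by
    rw [Filter.eventually_all_finset]
    intro φ _
    exact (((hI (E (F φ))).tendsto θ).comp hθ).eventually_lt_const (by linarith)
  have hev2 : ∀ᶠ N : ℕ in atTop, Real.log t.card ≤ (N : ℝ) * (δ / 2) :=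
    (tendsto_natCast_atTop_atTop.atTop_mul_const (by positivity)).eventually_ge_atTop _
  filter_upwards [hev, hev2, eventually_ne_atTop 0] with N h1 h2 hN
  have hNpos : (0 : ℝ) < N := by exact_mod_cast Nat.pos_of_ne_zero hN
  set P : Measure (Fin N → M) := Measure.pi fun _ : Fin N => (θseq N : Measure M) with hP
  have hint : ∀ u : (Fin N → M) → ℝ, Continuous u → Integrable u P := fun u hu =>
    hu.integrable_of_hasCompactSupport (HasCompactSupport.of_compactSpace _)
  have hc1 : Continuous fun y : Fin N → M => Real.exp (-(N : ℝ) * h (empiricalMeasure N y)) :=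
    Real.continuous_exp.comp (continuous_const.mul (hcont.comp (aux_emp_cont N)))
  let G : ProbabilityMeasure M → (Fin N → M) → ℝ := fun φ y =>
    Real.exp (-(N * (I (E (F φ)) θ - 1 + a))) * ∏ i, Real.exp (F φ (y i))
  have hGc : ∀ φ, Continuous (G φ) := fun φ => by fun_prop
  have hGpos : ∀ φ y, 0 < G φ y := fun φ y =>
    mul_pos (Real.exp_pos _) (Finset.prod_pos fun i _ => Real.exp_pos _)
  have hptw : ∀ y, Real.exp (-(N : ℝ) * h (empiricalMeasure N y)) ≤ ∑ φ ∈ t, G φ y := by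
    intro y
    have := ht (Set.mem_univ (empiricalMeasure N y))
    simp only [Set.mem_iUnion, exists_prop] at this
    obtain ⟨φ, hφt, hφ⟩ := this
    refine le_trans ?_ (Finset.single_le_sum (fun φ _ => (hGpos φ y).le) hφt)
    have hφ' : a - h (empiricalMeasure N y) <
      (N : ℝ)⁻¹ * ∑ i, F φ (y i) - (I (E (F φ)) θ - 1) := by
      rw [← aux_emp_integral hN y (F φ).continuous]; exact hφ
    have h3 := mul_lt_mul_of_pos_left hφ' hNpos
    rw [mul_sub, mul_sub (N:ℝ) (_ * _), ← mul_assoc, mul_inv_cancel₀ hNpos.ne', one_mul] at h3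
    change _ ≤ Real.exp (-(N * (I (E (F φ)) θ - 1 + a))) * ∏ i, Real.exp (F φ (y i))
    rw [← Real.exp_sum, ← Real.exp_add]
    apply Real.exp_le_exp.2
    linarith
  have hGint : ∀ φ ∈ t, ∫ y, G φ y ∂P ≤ Real.exp (N * (δ / 2 - a)) := by
    intro φ hφ
    have e1 : ∫ y, G φ y ∂P = Real.exp (-(N * (I (E (F φ)) θ - 1 + a))) *
        (I (E (F φ)) (θseq N)) ^ N := by
      change ∫ y, Real.exp (-(N * (I (E (F φ)) θ - 1 + a))) * ∏ i, Real.exp (F φ (y i)) ∂P = _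
      rw [integral_const_mul, hP,
        integral_fintype_prod_eq_prod (fun _ : Fin N => fun x => Real.exp (F φ x))]
      simp [I, E]
    have hx0 : 0 ≤ I (E (F φ)) (θseq N) := integral_nonneg fun x => (Real.exp_pos _).le
    have hx1 : I (E (F φ)) (θseq N) ≤ Real.exp (I (E (F φ)) (θseq N) - 1) := by
      have := Real.add_one_le_exp (I (E (F φ)) (θseq N) - 1)
      linarith
    have hx2 := pow_le_pow_left₀ hx0 hx1 N
    rw [← Real.exp_nat_mul] at hx2
    rw [e1]
    refine (mul_le_mul_of_nonneg_left hx2 (Real.exp_pos _).le).trans ?_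
    rw [← Real.exp_add]
    apply Real.exp_le_exp.2
    have := mul_lt_mul_of_pos_left (h1 φ hφ) hNpos
    linarith
  have hpos : 0 < ∫ y, Real.exp (-(N : ℝ) * h (empiricalMeasure N y)) ∂P :=
    integral_exp_pos (hint _ hc1)
  have hle : ∫ y, Real.exp (-(N : ℝ) * h (empiricalMeasure N y)) ∂P ≤
      t.card * Real.exp (N * (δ / 2 - a)) := by
    calc _ ≤ ∫ y, ∑ φ ∈ t, G φ y ∂P :=
          integral_mono (hint _ hc1) (hint _ (continuous_finset_sum _ fun φ _ => hGc φ)) hptw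
      _ = ∑ φ ∈ t, ∫ y, G φ y ∂P := integral_finset_sum _ fun φ _ => hint _ (hGc φ)
      _ ≤ ∑ φ ∈ t, Real.exp (N * (δ / 2 - a)) := Finset.sum_le_sum hGint
      _ = _ := by simp
  have hcard : (t.card : ℝ) ≠ 0 := by
    intro h0
    rw [h0, zero_mul] at hle
    linarith
  have hlog := Real.log_le_log hpos hle
  rw [Real.log_mul hcard (Real.exp_pos _).ne', Real.log_exp] at hlog
  have h4 := mul_le_mul_of_nonneg_left (hlog.trans (add_le_add_left h2 _)) (inv_pos.2 hNpos).le
  have h5 : (N : ℝ)⁻¹ * (N * (δ / 2) + N * (δ / 2 - a)) = δ - a := by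
    field_simp; ring
  rw [h5] at h4
  linarith

/-- Lower Laplace bound: liminf V_N ≥ inf [H(φ|θ) + h(φ)]. -/
theorem stmt3 {M : Type*} [MetricSpace M] [CompactSpace M] [Nonempty M]
    [MeasurableSpace M] [BorelSpace M]
    (θseq : ℕ → ProbabilityMeasure M) (θ : ProbabilityMeasure M)
    (hθ : Tendsto θseq atTop (𝓝 θ))
    (h : ProbabilityMeasure M → ℝ) (hcont : Continuous h) (hbdd : ∃ C, ∀ φ, |h φ| ≤ C)
    (V : ℕ → ℝ)
    (hV : ∀ N, V N = -((N : ℝ)⁻¹ * Real.log (∫ y : Fin N → M,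
      Real.exp (-(N : ℝ) * h (empiricalMeasure N y))
        ∂ (Measure.pi fun _ : Fin N => (θseq N : Measure M))))) :
    liminf (fun N => ((V N : ℝ) : EReal)) atTop ≥
      ⨅ φ : ProbabilityMeasure M,
        ((relEntropy (φ : Measure M) (θ : Measure M) : ℝ≥0∞) : EReal) + ((h φ : ℝ) : EReal) := by
  refine EReal.ge_of_forall_gt_iff_ge.1 fun b hb => ?_
  obtain ⟨a, hba, ha⟩ := EReal.lt_iff_exists_real_btwn.1 hb
  have hba' : b < a := by exact_mod_cast hba
  have hev := aux_main θseq θ hθ h hcont a (fun φ => by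
    have h1 := ha.trans_le (iInf_le _ φ)
    rw [EReal.coe_sub]
    exact EReal.sub_lt_of_lt_add h1) (a - b) (by linarith)
  refine le_liminf_of_le (h := ?_)
  filter_upwards [hev] with N hN
  rw [hV N]
  exact EReal.coe_le_coe_iff.2 (by linarith)
end

section
/- Let F : M × 𝒫(M) → M be continuous and (Q_x)_{x∈M} a family of Borel probability measures on M depending continuously on x in the weak topology. Then the map 𝓕 : 𝒫(M) → 𝒫(M) defined by 𝓕(φ)(A) := ∫_M Q_{F(x,φ)}(A) φ(dx) is continuous with respect to the topology of weak convergence on 𝒫(M). -/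
open MeasureTheory Filter Topology ProbabilityTheory
open scoped ENNReal NNReal Classical

/-- A weakly continuous family of probability measures is measurable as a map into measures. -/
theorem measurable_of_weak_continuous {X M : Type*} [TopologicalSpace X] [MeasurableSpace X]
    [OpensMeasurableSpace X] [MetricSpace M] [MeasurableSpace M] [BorelSpace M]
    (Q : X → ProbabilityMeasure M) (hQ : Continuous Q) :
    Measurable (fun x => (Q x : Measure M)) := by
  refine Measurable.measure_of_isPiSystem_of_isProbabilityMeasure
    (S := {s | IsClosed s}) ?_ ?_ ?_
  · rw [BorelSpace.measurable_eq (α := M), borel_eq_generateFrom_isClosed]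
  · exact isPiSystem_isClosed
  · intro s hs
    have hs' : IsClosed s := hs
    refine measurable_of_tendsto_metrizable
      (f := fun n x => ∫⁻ y, (hs'.apprSeq n y : ℝ≥0∞) ∂(Q x : Measure M)) ?_ ?_
    · intro n
      exact (ProbabilityMeasure.continuous_iff_forall_continuous_lintegral.1 hQ _).measurable
    · rw [tendsto_pi_nhds]
      intro x
      exact HasOuterApproxClosed.tendsto_lintegral_apprSeq hs' (Q x : Measure M)

/-- Joint continuity: integrating a jointly continuous function against the parameter measure. -/
theorem continuous_integral_param {M : Type*} [MetricSpace M] [CompactSpace M]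
    [MeasurableSpace M] [BorelSpace M]
    (g : M × ProbabilityMeasure M → ℝ) (hg : Continuous g) :
    Continuous (fun φ : ProbabilityMeasure M => ∫ x, g (x, φ) ∂(φ : Measure M)) := by
  let G : C(ProbabilityMeasure M, C(M, ℝ)) :=
    ContinuousMap.curry ⟨fun p => g (p.2, p.1), by fun_prop⟩
  have hint : ∀ (ψ φ : ProbabilityMeasure M), Integrable (G ψ) (φ : Measure M) := fun ψ φ =>
    (BoundedContinuousFunction.mkOfCompact (G ψ)).integrable (φ : Measure M)
  rw [continuous_iff_continuousAt]
  intro φ₀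
  have h1 : Tendsto (fun φ : ProbabilityMeasure M => ∫ x, G φ₀ x ∂(φ : Measure M)) (𝓝 φ₀)
      (𝓝 (∫ x, G φ₀ x ∂(φ₀ : Measure M))) :=
    (ProbabilityMeasure.continuous_integral_continuousMap (G φ₀)).continuousAt
  have h2 : Tendsto (fun φ : ProbabilityMeasure M => ‖G φ - G φ₀‖) (𝓝 φ₀) (𝓝 0) := by
    have : Continuous (fun φ : ProbabilityMeasure M => ‖G φ - G φ₀‖) := by fun_prop
    simpa using this.tendsto φ₀
  have h3 : Tendsto (fun φ : ProbabilityMeasure M =>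
      ∫ x, (G φ - G φ₀) x ∂(φ : Measure M)) (𝓝 φ₀) (𝓝 0) := by
    refine squeeze_zero_norm (fun φ => ?_) h2
    simpa using norm_integral_le_of_norm_le_const (μ := (φ : Measure M))
      (Eventually.of_forall fun x => (G φ - G φ₀).norm_coe_le_norm x)
  have h4 := h3.add h1
  rw [zero_add] at h4
  refine Tendsto.congr (fun φ => ?_) h4
  rw [← integral_add (by simpa using (hint φ φ).sub (hint φ₀ φ)) (hint φ₀ φ)]
  refine integral_congr_ae (Eventually.of_forall fun x => ?_)
  simp [G]

/-- Continuity of the nonlinear (noisy) Frobenius-Perron map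
`𝓕(φ)(A) = ∫ Q_{F(x,φ)}(A) φ(dx)` in the topology of weak convergence. -/
theorem stmt11 {M : Type*} [MetricSpace M] [CompactSpace M]
    [MeasurableSpace M] [BorelSpace M]
    (F : M × ProbabilityMeasure M → M) (hF : Continuous F)
    (Q : M → ProbabilityMeasure M) (hQ : Continuous Q)
    (𝓕 : ProbabilityMeasure M → ProbabilityMeasure M)
    (h𝓕 : ∀ φ : ProbabilityMeasure M,
      (𝓕 φ : Measure M) = (φ : Measure M).bind (fun x => (Q (F (x, φ)) : Measure M))) :
    Continuous 𝓕 := by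
  rw [ProbabilityMeasure.continuous_iff_forall_continuous_lintegral]
  intro f
  let G : M × ProbabilityMeasure M → ℝ≥0 := fun p => (Q (F p)).toFiniteMeasure.testAgainstNN f
  have hG : Continuous G :=
    (ProbabilityMeasure.continuous_testAgainstNN_eval f).comp (hQ.comp hF)
  have hgc : Continuous (fun p => (G p : ℝ)) := NNReal.continuous_coe.comp hG
  have key := ENNReal.continuous_ofReal.comp (continuous_integral_param _ hgc)
  refine key.congr fun φ => ?_
  have hm : Measurable (fun x => (Q (F (x, φ)) : Measure M)) :=
    measurable_of_weak_continuous (fun x => Q (F (x, φ))) (by fun_prop)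
  have hfm : Measurable (fun y => (f y : ℝ≥0∞)) := f.continuous.measurable.coe_nnreal_ennreal
  rw [h𝓕 φ, Measure.lintegral_bind hm.aemeasurable hfm.aemeasurable]
  simp only [Function.comp]
  have hc : Continuous (fun x => (G (x, φ) : ℝ)) := by fun_prop
  have hi : Integrable (fun x => (G (x, φ) : ℝ)) (φ : Measure M) :=
    (BoundedContinuousFunction.mkOfCompact ⟨_, hc⟩).integrable (φ : Measure M)
  rw [ofReal_integral_eq_lintegral_ofReal hi
    (Eventually.of_forall fun x => (G (x, φ)).2)]
  refine lintegral_congr fun x => ?_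
  rw [ENNReal.ofReal_coe_nnreal]
  exact FiniteMeasure.testAgainstNN_coe_eq
end

section
/- Let b ∈ ℝ with |b| < 1 and m ∈ ℝ. Then the infimum, over all n ≥ 1 and all finite sequences (u_0, u_1, …, u_n) of real numbers with u_0 = 0 and u_n = m, of the action Σ_{j=1}^n (u_j − b·u_{j−1})², equals (1 − b²)·m². (Consequently, for the linearly coupled system of noisy linear maps with v* := σ²/(1−a²) and b := (1+κ)a, the contracted quasipotential approximation is φ(m) = ((1 − (1+κ)² a²)/(2 v*)) m².) -/
open MeasureTheory Filter Topology ProbabilityTheory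
open scoped ENNReal NNReal Classical


/-- The action of a discrete path `u_0, …, u_n` for the linear map `u ↦ b u` with additive
Gaussian perturbations: `Σ_{j=1}^n (u_j - b u_{j-1})²`. -/
noncomputable def pathAction (b : ℝ) (n : ℕ) (u : Fin (n + 1) → ℝ) : ℝ :=
  ∑ j : Fin n, (u j.succ - b * u j.castSucc) ^ 2

/-- Time-reversal identity for the action. -/
theorem pathAction_eq (b : ℝ) (n : ℕ) (u : Fin (n + 1) → ℝ) :
    pathAction b n u = (1 - b ^ 2) * (u (Fin.last n) ^ 2 - u 0 ^ 2)
      + ∑ j : Fin n, (u j.castSucc - b * u j.succ) ^ 2 := by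
  have ht : ∑ j : Fin n, (u j.succ ^ 2 - u j.castSucc ^ 2) = u (Fin.last n) ^ 2 - u 0 ^ 2 := by
    have h1 := Fin.sum_univ_succ (fun j : Fin (n + 1) => u j ^ 2)
    have h2 := Fin.sum_univ_castSucc (fun j : Fin (n + 1) => u j ^ 2)
    rw [Finset.sum_sub_distrib]
    linarith
  rw [← ht, Finset.mul_sum, ← Finset.sum_add_distrib, pathAction]
  refine Finset.sum_congr rfl fun j _ => ?_
  ring

theorem quasi_aux (b m : ℝ) (hb : |b| < 1) :
    sInf {A : ℝ | ∃ n : ℕ, 0 < n ∧ ∃ u : Fin (n + 1) → ℝ,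
          u 0 = 0 ∧ u (Fin.last n) = m ∧ A = pathAction b n u}
        = (1 - b ^ 2) * m ^ 2 := by
  have hlow : ∀ A ∈ {A : ℝ | ∃ n : ℕ, 0 < n ∧ ∃ u : Fin (n + 1) → ℝ,
          u 0 = 0 ∧ u (Fin.last n) = m ∧ A = pathAction b n u}, (1 - b ^ 2) * m ^ 2 ≤ A := by
    rintro A ⟨n, -, u, h0, hm, rfl⟩
    rw [pathAction_eq, h0, hm]
    have : 0 ≤ ∑ j : Fin n, (u j.castSucc - b * u j.succ) ^ 2 :=
      Finset.sum_nonneg fun j _ => sq_nonneg _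
    linarith
  have hmem : ∀ k : ℕ, (1 - b ^ 2) * m ^ 2 + (b * (b ^ k * m)) ^ 2 ∈
      {A : ℝ | ∃ n : ℕ, 0 < n ∧ ∃ u : Fin (n + 1) → ℝ,
          u 0 = 0 ∧ u (Fin.last n) = m ∧ A = pathAction b n u} := by
    intro k
    refine ⟨k + 1, k.succ_pos,
      Fin.cons 0 (fun j : Fin (k + 1) => b ^ (k - (j : ℕ)) * m), rfl, ?_, ?_⟩
    · rw [← Fin.succ_last, Fin.cons_succ]
      simp
    · rw [pathAction_eq, Fin.sum_univ_succ, ← Fin.succ_last]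
      have : ∀ j : Fin k, b ^ (k - (j : ℕ)) * m - b * (b ^ (k - ((j : ℕ) + 1)) * m) = 0 := by
        intro j
        have : k - (j : ℕ) = (k - ((j : ℕ) + 1)) + 1 := by omega
        rw [this, pow_succ]
        ring
      simp [← Fin.succ_castSucc, this]
  have hlim : Tendsto (fun k : ℕ => (1 - b ^ 2) * m ^ 2 + (b * (b ^ k * m)) ^ 2) atTop
      (𝓝 ((1 - b ^ 2) * m ^ 2)) := by
    have h := ((((tendsto_pow_atTop_nhds_zero_of_abs_lt_one hb).mul_const m).const_mul b).pow
      2).const_add ((1 - b ^ 2) * m ^ 2)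
    simpa using h
  apply le_antisymm
  · exact ge_of_tendsto' hlim fun k => csInf_le ⟨_, hlow⟩ (hmem k)
  · exact le_csInf ⟨_, hmem 0⟩ hlow

/-- The quasipotential of the linear map `u ↦ b u` with `|b| < 1`:
the infimum over all paths from `0` to `m` of the action equals `(1 - b²) m²`.
Consequently, for the linearly coupled noisy linear maps with `b = (1+κ)a` and
`v* = σ²/(1-a²)`, the contracted quasipotential is
`φ(m) = ((1-(1+κ)²a²)/(2v*)) m²` (eq. (4b-100) of the paper). -/
theorem stmt14 :
    (∀ b m : ℝ, |b| < 1 →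
      sInf {A : ℝ | ∃ n : ℕ, 0 < n ∧ ∃ u : Fin (n + 1) → ℝ,
          u 0 = 0 ∧ u (Fin.last n) = m ∧ A = pathAction b n u}
        = (1 - b ^ 2) * m ^ 2)
    ∧ (∀ κ a σ m : ℝ, 0 < σ → |a| < 1 → |(1 + κ) * a| < 1 →
      sInf {A : ℝ | ∃ n : ℕ, 0 < n ∧ ∃ u : Fin (n + 1) → ℝ,
          u 0 = 0 ∧ u (Fin.last n) = m ∧ A = pathAction ((1 + κ) * a) n u}
        / (2 * (σ ^ 2 / (1 - a ^ 2)))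
      = ((1 - (1 + κ) ^ 2 * a ^ 2) / (2 * (σ ^ 2 / (1 - a ^ 2)))) * m ^ 2) := by
  refine ⟨quasi_aux, fun κ a σ m _ _ h => ?_⟩
  rw [quasi_aux _ m h]
  ring
end

section
/- Let m, u ∈ ℝ and v > 0, and let 𝒩(m, v) denote the Gaussian probability measure on ℝ with mean m and variance v. Then the infimum of the relative entropy H(χ | 𝒩(m, v)) over all Borel probability measures χ on ℝ with finite first moment and mean ∫_ℝ x χ(dx) = u equals (u − m)²/(2v), and it is attained by χ = 𝒩(u, v). -/
open MeasureTheory Filter Topology ProbabilityTheory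
open scoped ENNReal NNReal Classical

lemma gauss_integral_exp (m t : ℝ) (w : ℝ≥0) :
    ∫ x, Real.exp (t * x) ∂(gaussianReal m w) = Real.exp (m * t + w * t ^ 2 / 2) := by
  have h := congrFun (mgf_fun_id_gaussianReal (μ := m) (v := w)) t
  simpa [mgf] using h

lemma gauss_tilted (m u : ℝ) (w : ℝ≥0) (hw : w ≠ 0) :
    (gaussianReal m w).tilted (fun x => (u - m) / w * x) = gaussianReal u w := by
  have hw' : (w : ℝ) ≠ 0 := by exact_mod_cast hw
  rw [Measure.tilted, gauss_integral_exp, gaussianReal_of_var_ne_zero _ hw,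
    gaussianReal_of_var_ne_zero _ hw,
    ← withDensity_mul _ (measurable_gaussianPDF m w) (by fun_prop)]
  congr 1
  ext x
  simp only [Pi.mul_apply, gaussianPDF]
  rw [← ENNReal.ofReal_mul (gaussianPDFReal_nonneg _ _ _)]
  congr 1
  simp only [gaussianPDFReal]
  rw [← Real.exp_sub, mul_assoc, ← Real.exp_add]
  congr 2
  field_simp
  ring

lemma gauss_self (m u : ℝ) (w : ℝ≥0) (hw : w ≠ 0) :
    relEntropy (gaussianReal u w) (gaussianReal m w)
      = ENNReal.ofReal ((u - m) ^ 2 / (2 * w)) := by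
  have hw' : (w : ℝ) ≠ 0 := by exact_mod_cast hw
  have hac : gaussianReal u w ≪ gaussianReal m w := by
    rw [← gauss_tilted m u w hw]; exact tilted_absolutelyContinuous _ _
  have hl : llr (gaussianReal u w) (gaussianReal m w) =ᵐ[gaussianReal u w]
      fun x => (u - m) / w * x - (m * ((u - m) / w) + w * ((u - m) / w) ^ 2 / 2) := by
    have h := log_rnDeriv_tilted_left_self
      (integrable_exp_mul_gaussianReal (μ := m) (v := w) ((u - m) / w))
    rw [gauss_tilted m u w hw, gauss_integral_exp, Real.log_exp] at h
    exact hac.ae_le h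
  have hid : Integrable (fun x : ℝ => x) (gaussianReal u w) :=
    (memLp_id_gaussianReal (μ := u) (v := w) 1).integrable le_rfl
  have hint : Integrable (llr (gaussianReal u w) (gaussianReal m w)) (gaussianReal u w) :=
    ((hid.const_mul _).sub (integrable_const _)).congr hl.symm
  rw [relEntropy, if_pos ⟨hac, hint⟩, integral_congr_ae hl,
    integral_sub (hid.const_mul _) (integrable_const _), integral_const_mul,
    integral_id_gaussianReal]
  congr 1
  simp
  field_simp
  ring

lemma gauss_lower (m u : ℝ) (w : ℝ≥0) (hw : w ≠ 0) (χ : Measure ℝ) [IsProbabilityMeasure χ]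
    (hχ : Integrable (fun x => x) χ) (hu : ∫ x, x ∂χ = u) :
    ENNReal.ofReal ((u - m) ^ 2 / (2 * w)) ≤ relEntropy χ (gaussianReal m w) := by
  have hw' : (w : ℝ) ≠ 0 := by exact_mod_cast hw
  unfold relEntropy
  split_ifs with h
  · obtain ⟨hac, hint⟩ := h
    apply ENNReal.ofReal_le_ofReal
    have he := integrable_exp_mul_gaussianReal (μ := m) (v := w) ((u - m) / w)
    have hf : Integrable (fun x => (u - m) / w * x) χ := hχ.const_mul _
    have h1 := integral_llr_tilted_right hac hf he hint
    have h2 := integrable_llr_tilted_right hac hf hint he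
    have h3 := hac.trans (absolutelyContinuous_tilted he)
    have h4 := InformationTheory.integral_llr_add_sub_measure_univ_nonneg h3 h2
    rw [gauss_tilted m u w hw] at h1 h4
    rw [gauss_integral_exp, Real.log_exp, integral_const_mul, hu] at h1
    simp only [probReal_univ, add_sub_cancel_right, h1] at h4
    have h5 : (u - m) ^ 2 / (2 * w)
      = (u - m) / w * u - (m * ((u - m) / w) + w * ((u - m) / w) ^ 2 / 2) := by
      field_simp
      ring
    linarith
  · exact le_top

/-- The minimal relative entropy with respect to `𝒩(m,v)` over probability measures on `ℝ`
with mean `u` is `(u-m)²/(2v)`, attained by `𝒩(u,v)`. -/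
theorem stmt15 (m u v : ℝ) (hv : 0 < v) :
    (⨅ (χ : Measure ℝ) (_ : IsProbabilityMeasure χ) (_ : Integrable (fun x => x) χ)
        (_ : ∫ x, x ∂χ = u),
        relEntropy χ (gaussianReal m (⟨v, hv.le⟩ : ℝ≥0)))
      = ENNReal.ofReal ((u - m) ^ 2 / (2 * v))
    ∧ relEntropy (gaussianReal u (⟨v, hv.le⟩ : ℝ≥0)) (gaussianReal m (⟨v, hv.le⟩ : ℝ≥0))
      = ENNReal.ofReal ((u - m) ^ 2 / (2 * v)) := by
  have hw : (⟨v, hv.le⟩ : ℝ≥0) ≠ 0 := fun h => hv.ne' (congrArg NNReal.toReal h)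
  have hs := gauss_self m u ⟨v, hv.le⟩ hw
  refine ⟨le_antisymm ?_ ?_, hs⟩
  · refine le_trans ?_ hs.le
    exact iInf_le_of_le _ (iInf_le_of_le (instIsProbabilityMeasureGaussianReal u _) (iInf_le_of_le
      ((memLp_id_gaussianReal 1).integrable le_rfl)
      (iInf_le_of_le integral_id_gaussianReal le_rfl)))
  · exact le_iInf fun χ => le_iInf fun _ => le_iInf fun hχ => le_iInf fun hu =>
      gauss_lower m u ⟨v, hv.le⟩ hw χ hχ hu
end
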